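/- Let p and r be real numbers with p > 0 and r > 2*p, and let g(x,y,p,r) be the polynomial defined in the context. Define α = sqrt((p*r^2)^(2/3)*r^2 + 6*r^2*p^2*2^(1/3) - 3*(p*r^2)^(1/3)*p*r^2*2^(2/3) - 4*(p*r^2)^(2/3)*p^2) / (p*r^2)^(1/3), β = p*r^2*(22*r^6*(p*r^2)^(2/3) + 1452*r^6*p^2*2^(1/3) + 7456*p^3*r^4*2^(2/3)*(p*r^2)^(1/3) - 6560*p^2*r^4*(p*r^2)^(2/3) - 15488*p^4*r^4*2^(1/3) - 39680*p^5*r^2*2^(2/3)*(p*r^2)^(1/3) + 37600*p^4*r^2*(p*r^2)^(2/3) + 7936*p^8*2^(1/3) - 15872*p^7*2^(2/3)*(p*r^2)^(1/3) + 45760*p^6*r^2*2^(1/3) - 33*r^8*2^(1/3) - 5376*p^6*(p*r^2)^(2/3)), and γ = 2*(p*r^2)^(1/3)*(8640*p^6*r^2*(p*r^2)^(1/3) - 3968*p^7*2^(1/3)*(p*r^2)^(2/3) + 1984*p^7*r^2*2^(2/3) - 3920*r^4*p^4*(p*r^2)^(1/3) - 9920*p^5*r^2*2^(1/3)*(p*r^2)^(2/3)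 + 4960*p^5*r^4*2^(2/3) + 484*r^6*p^2*(p*r^2)^(1/3) + 1864*p^3*r^4*2^(1/3)*(p*r^2)^(2/3) - 932*p^3*r^6*2^(2/3) - 11*r^8*(p*r^2)^(1/3)), where all fractional powers denote real powers of positive real numbers. Then the radicand defining α is nonnegative, γ ≠ 0, and the two points S2 = (α, β/γ) and S3 = (-α, β/γ) are singular points of the variety V(g): at each of these two points g = 0, ∂g/∂x = 0 and ∂g/∂y = 0 (partial derivatives taken with respect to x and y). -/

import Mathlib

/-- The degree-six polynomial defining the parallel lines to the parabola 4*p*y = x^2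
at offset r. -/
noncomputable def gPar (x y p r : ℝ) : ℝ :=
  -2*p*r^2*y*x^2 + 8*p*r^2*y^3 + 8*p^2*r^2*y^2 - 32*y*p^3*r^2 + 16*p^4*r^2 - 16*y^4*p^2 +
    32*y^3*p^3 - 16*p^4*y^2 + 3*r^2*x^4 + 8*p^2*r^4 + 20*p^2*r^2*x^2 - y^2*x^4 + 10*y*p*x^4 -
    x^6 - x^4*p^2 + 8*p*y^3*x^2 - 32*x^2*y^2*p^2 + 8*x^2*y*p^3 - 3*r^4*x^2 + 2*r^2*x^2*y^2 +
    r^6 - r^4*y^2 - 8*p*r^4*y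

/-- The radicand appearing in the x-coordinate of the off-axis singular points. -/
noncomputable def radPar (p r : ℝ) : ℝ :=
  (p*r^2)^((2:ℝ)/3)*r^2 + 6*r^2*p^2*(2:ℝ)^((1:ℝ)/3) -
    3*(p*r^2)^((1:ℝ)/3)*p*r^2*(2:ℝ)^((2:ℝ)/3) - 4*(p*r^2)^((2:ℝ)/3)*p^2

/-- The x-coordinate α of the off-axis singular points. -/
noncomputable def alphaPar (p r : ℝ) : ℝ :=
  Real.sqrt (radPar p r) / (p*r^2)^((1:ℝ)/3)

/-- The numerator β of the y-coordinate of the off-axis singular points. -/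
noncomputable def betaPar (p r : ℝ) : ℝ :=
  p*r^2*(22*r^6*(p*r^2)^((2:ℝ)/3) + 1452*r^6*p^2*(2:ℝ)^((1:ℝ)/3) +
    7456*p^3*r^4*(2:ℝ)^((2:ℝ)/3)*(p*r^2)^((1:ℝ)/3) - 6560*p^2*r^4*(p*r^2)^((2:ℝ)/3) -
    15488*p^4*r^4*(2:ℝ)^((1:ℝ)/3) - 39680*p^5*r^2*(2:ℝ)^((2:ℝ)/3)*(p*r^2)^((1:ℝ)/3) +
    37600*p^4*r^2*(p*r^2)^((2:ℝ)/3) + 7936*p^8*(2:ℝ)^((1:ℝ)/3) -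
    15872*p^7*(2:ℝ)^((2:ℝ)/3)*(p*r^2)^((1:ℝ)/3) + 45760*p^6*r^2*(2:ℝ)^((1:ℝ)/3) -
    33*r^8*(2:ℝ)^((1:ℝ)/3) - 5376*p^6*(p*r^2)^((2:ℝ)/3))

/-- The denominator γ of the y-coordinate of the off-axis singular points. -/
noncomputable def gammaPar (p r : ℝ) : ℝ :=
  2*(p*r^2)^((1:ℝ)/3)*(8640*p^6*r^2*(p*r^2)^((1:ℝ)/3) -
    3968*p^7*(2:ℝ)^((1:ℝ)/3)*(p*r^2)^((2:ℝ)/3) + 1984*p^7*r^2*(2:ℝ)^((2:ℝ)/3) -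
    3920*r^4*p^4*(p*r^2)^((1:ℝ)/3) - 9920*p^5*r^2*(2:ℝ)^((1:ℝ)/3)*(p*r^2)^((2:ℝ)/3) +
    4960*p^5*r^4*(2:ℝ)^((2:ℝ)/3) + 484*r^6*p^2*(p*r^2)^((1:ℝ)/3) +
    1864*p^3*r^4*(2:ℝ)^((1:ℝ)/3)*(p*r^2)^((2:ℝ)/3) - 932*p^3*r^6*(2:ℝ)^((2:ℝ)/3) -
    11*r^8*(p*r^2)^((1:ℝ)/3))

lemma gPar_even (x y p r : ℝ) : gPar x y p r =
    -2*p*(r^2)*y*(x^2) + 8*p*(r^2)*y^3 + 8*p^2*(r^2)*y^2 - 32*y*p^3*(r^2) + 16*p^4*(r^2)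
    - 16*y^4*p^2 + 32*y^3*p^3 - 16*p^4*y^2 + 3*(r^2)*(x^2)^2 + 8*p^2*(r^2)^2
    + 20*p^2*(r^2)*(x^2) - y^2*(x^2)^2 + 10*y*p*(x^2)^2 - (x^2)^3 - (x^2)^2*p^2
    + 8*p*y^3*(x^2) - 32*(x^2)*y^2*p^2 + 8*(x^2)*y*p^3 - 3*(r^2)^2*(x^2)
    + 2*(r^2)*(x^2)*y^2 + (r^2)^3 - (r^2)^2*y^2 - 8*p*(r^2)^2*y := by
  unfold gPar; ring

lemma gPar_deriv_x (x y p r : ℝ) : deriv (fun t : ℝ => gPar t y p r) x =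
    2*x*((-2*p*(r^2)*y + 20*p^2*(r^2) + 8*p*y^3 - 32*y^2*p^2 + 8*y*p^3 - 3*(r^2)^2
      + 2*(r^2)*y^2) + 2*(3*(r^2) - y^2 + 10*y*p - p^2)*(x^2) - 3*(x^2)^2) := by
  have h : HasDerivAt (fun t : ℝ => gPar t y p r) _ x :=
    HasDerivAt.congr_of_eventuallyEq
      (f := fun t : ℝ => ((gPar 0 y p r
        + (-2*p*r^2*y + 20*p^2*r^2 + 8*p*y^3 - 32*y^2*p^2 + 8*y*p^3 - 3*r^4 + 2*r^2*y^2)*t^2)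
        + (3*r^2 - y^2 + 10*y*p - p^2)*t^4) + (-1)*t^6)
      (((((hasDerivAt_pow 2 x).const_mul _).const_add _).add
        ((hasDerivAt_pow 4 x).const_mul _)).add ((hasDerivAt_pow 6 x).const_mul _))
      (Filter.Eventually.of_forall fun t => by simp only [gPar]; ring)
  rw [h.deriv]; norm_num; ring

lemma gPar_deriv_y (x y p r : ℝ) : deriv (fun t : ℝ => gPar x t p r) y =
    (-2*p*(r^2)*(x^2) - 32*p^3*(r^2) + 10*p*(x^2)^2 + 8*(x^2)*p^3 - 8*p*(r^2)^2)
    + 2*(8*p^2*(r^2) - 16*p^4 - (x^2)^2 - 32*(x^2)*p^2 + 2*(r^2)*(x^2) - (r^2)^2)*y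
    + 3*(8*p*(r^2) + 32*p^3 + 8*p*(x^2))*y^2 - 64*p^2*y^3 := by
  have h : HasDerivAt (fun t : ℝ => gPar x t p r) _ y :=
    HasDerivAt.congr_of_eventuallyEq
      (f := fun t : ℝ => (((gPar x 0 p r
        + (-2*p*(r^2)*(x^2) - 32*p^3*(r^2) + 10*p*x^4 + 8*(x^2)*p^3 - 8*p*r^4)*t^1)
        + (8*p^2*(r^2) - 16*p^4 - x^4 - 32*(x^2)*p^2 + 2*(r^2)*(x^2) - r^4)*t^2)
        + (8*p*(r^2) + 32*p^3 + 8*p*(x^2))*t^3) + (-16*p^2)*t^4)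
      ((((((hasDerivAt_pow 1 y).const_mul _).const_add _).add
        ((hasDerivAt_pow 2 y).const_mul _)).add ((hasDerivAt_pow 3 y).const_mul _)).add
        ((hasDerivAt_pow 4 y).const_mul _))
      (Filter.Eventually.of_forall fun t => by simp only [gPar]; ring)
  rw [h.deriv]; norm_num; ring

/-- The singular conditions at the centre-of-curvature point. -/
lemma sing_at (x p r v : ℝ) (hx : x^2 = 4*p^2*(v-1)^3) (hr : r^2 = 4*p^2*v^3) :
    gPar x (p*(3*v-1)) p r = 0 ∧
    deriv (fun t : ℝ => gPar t (p*(3*v-1)) p r) x = 0 ∧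
    deriv (fun t : ℝ => gPar x t p r) (p*(3*v-1)) = 0 := by
  refine ⟨?_, ?_, ?_⟩
  · rw [gPar_even, hx, hr]; ring
  · rw [gPar_deriv_x, hx, hr]; ring
  · rw [gPar_deriv_y, hx, hr]; ring

/-- The common factor of numerator and denominator. -/
noncomputable def Gfac (v : ℝ) : ℝ :=
  -11*v^11 + 121*v^8 - 233*v^7 + 233*v^6 - 245*v^5 + 310*v^4 - 310*v^3 + 135*v^2 + 31*v - 31

lemma Gfac_neg (v : ℝ) (hv : 1 < v) : Gfac v < 0 := by
  obtain ⟨w, rfl⟩ : ∃ w, v = w + 1 := ⟨v - 1, by ring⟩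
  have hw : 0 < w := by linarith
  have : Gfac (w+1) = -(w^3*(54 + 735*w + 2046*w^2 + 3092*w^3 + 2895*w^4 + 1694*w^5
      + 605*w^6 + 121*w^7 + 11*w^8)) := by unfold Gfac; ring
  rw [this]
  have : 0 < w^3*(54 + 735*w + 2046*w^2 + 3092*w^3 + 2895*w^4 + 1694*w^5
      + 605*w^6 + 121*w^7 + 11*w^8) := by positivity
  linarith

lemma rpow_third (a : ℝ) (ha : 0 < a) :
    (a^((1:ℝ)/3))^3 = a ∧ a^((2:ℝ)/3) = (a^((1:ℝ)/3))^2 := by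
  constructor
  · rw [← Real.rpow_natCast, ← Real.rpow_mul ha.le]; norm_num
  · rw [← Real.rpow_natCast, ← Real.rpow_mul ha.le]; norm_num

theorem parabola_offaxis_singular_points (p r : ℝ) (hp : 0 < p) (hr : 2*p < r) :
    0 ≤ radPar p r ∧
    gammaPar p r ≠ 0 ∧
    gPar (alphaPar p r) (betaPar p r / gammaPar p r) p r = 0 ∧
    deriv (fun t : ℝ => gPar t (betaPar p r / gammaPar p r) p r) (alphaPar p r) = 0 ∧
    deriv (fun t : ℝ => gPar (alphaPar p r) t p r) (betaPar p r / gammaPar p r) = 0 ∧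
    gPar (-(alphaPar p r)) (betaPar p r / gammaPar p r) p r = 0 ∧
    deriv (fun t : ℝ => gPar t (betaPar p r / gammaPar p r) p r) (-(alphaPar p r)) = 0 ∧
    deriv (fun t : ℝ => gPar (-(alphaPar p r)) t p r) (betaPar p r / gammaPar p r) = 0 := by
  have hr0 : 0 < r := by linarith
  have hA : 0 < p*r^2 := by positivity
  obtain ⟨hu3, hu2⟩ := rpow_third (p*r^2) hA
  obtain ⟨hc3, hc2⟩ := rpow_third 2 two_pos
  have hu : 0 < (p*r^2)^((1:ℝ)/3) := Real.rpow_pos_of_pos hA _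
  have hc : 0 < (2:ℝ)^((1:ℝ)/3) := Real.rpow_pos_of_pos two_pos _
  have e1 := @alphaPar.eq_1 p r
  have e2 := @betaPar.eq_1 p r
  have e3 := @gammaPar.eq_1 p r
  have e4 := @radPar.eq_1 p r
  rw [hu2, hc2] at e2 e3 e4
  generalize (p*r^2)^((1:ℝ)/3) = u at *
  generalize (2:ℝ)^((1:ℝ)/3) = c at *
  obtain ⟨v, rfl⟩ : ∃ v, u = c^2*p*v := ⟨u/(c^2*p), by field_simp⟩
  have hv0 : 0 < v := by
    have : 0 < c^2*p := by positivity
    exact pos_of_mul_pos_right hu this.le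
  have hr2 : r^2 = 4*p^2*v^3 := by
    have : p*r^2 = p*(4*p^2*v^3) := by
      linear_combination -hu3 + p^3*v^3*(c^3+2)*hc3
    exact mul_left_cancel₀ hp.ne' this
  have hv : 1 < v := by
    by_contra hcon
    have h1 : v^3 ≤ 1 := pow_le_one₀ hv0.le (not_lt.mp hcon)
    have h2 : 0 < p^2 := by positivity
    nlinarith
  have r4 : r^4 = (4*p^2*v^3)^2 := by rw [← hr2]; ring
  have r6 : r^6 = (4*p^2*v^3)^3 := by rw [← hr2]; ring
  have r8 : r^8 = (4*p^2*v^3)^4 := by rw [← hr2]; ring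
  simp only [r8, r6, r4, hr2] at e2 e3 e4
  have hrad : radPar p r = 8*c*p^4*v^2*(v-1)^3 := by
    rw [e4]
    linear_combination (4*p^4*v^5*c - 12*p^4*v^4*c - 4*p^4*v^2*c)*hc3
  have hgam : gammaPar p r = 1024*c*p^10*v^3*Gfac v := by
    rw [e3, Gfac]
    linear_combination (2*p*v*(c*((8640)*p^6*(4*p^2*v^3)^1*(p*v)^1 +
      (1984)*p^7*(4*p^2*v^3)^1*(p*v)^0 +
      (-3920)*p^4*(4*p^2*v^3)^2*(p*v)^1 +
      (4960)*p^5*(4*p^2*v^3)^2*(p*v)^0 +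
      (484)*p^2*(4*p^2*v^3)^3*(p*v)^1 +
      (-932)*p^3*(4*p^2*v^3)^3*(p*v)^0 +
      (-11)*p^0*(4*p^2*v^3)^4*(p*v)^1)
      +
      (c^4+2*c)*((-3968)*p^7*1*(p*v)^2 +
      (-9920)*p^5*(4*p^2*v^3)^1*(p*v)^2 +
      (1864)*p^3*(4*p^2*v^3)^2*(p*v)^2)))*hc3
  have hbet : betaPar p r = p*(3*v-1)*(1024*c*p^10*v^3*Gfac v) := by
    rw [e2, Gfac]
    linear_combination (p*(4*p^2*v^3)*c*((22)*p^0*(4*p^2*v^3)^3*(p*v)^2 +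
      (7456)*p^3*(4*p^2*v^3)^2*(p*v)^1 +
      (-6560)*p^2*(4*p^2*v^3)^2*(p*v)^2 +
      (-39680)*p^5*(4*p^2*v^3)^1*(p*v)^1 +
      (37600)*p^4*(4*p^2*v^3)^1*(p*v)^2 +
      (-15872)*p^7*1*(p*v)^1 +
      (-5376)*p^6*1*(p*v)^2))*hc3
  have hG := Gfac_neg v hv
  have hg0 : gammaPar p r ≠ 0 := by
    rw [hgam]
    have : 1024*c*p^10*v^3 ≠ 0 := by positivity
    exact mul_ne_zero this hG.ne
  have hrad0 : 0 ≤ radPar p r := by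
    rw [hrad]
    have : 0 < v - 1 := by linarith
    positivity
  have hy : betaPar p r / gammaPar p r = p*(3*v-1) := by
    rw [div_eq_iff hg0, hbet, hgam]
  have hx : (alphaPar p r)^2 = 4*p^2*(v-1)^3 := by
    rw [e1, div_pow, Real.sq_sqrt hrad0, hrad, div_eq_iff (by positivity)]
    linear_combination (-4*p^4*v^2*(v-1)^3*c)*hc3
  obtain ⟨a1, a2, a3⟩ := sing_at _ p r v hx hr2
  obtain ⟨b1, b2, b3⟩ := sing_at (-(alphaPar p r)) p r v (by rw [neg_sq]; exact hx) hr2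
  rw [hy]
  exact ⟨hrad0, hg0, a1, a2, a3, b1, b2, b3⟩
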